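/- Let ν > 0, T > 0, and let (ω, ψ) be a smooth, space-periodic solution of the 2D vorticity Navier–Stokes equations with viscosity ν on ℝ² × [0,T]. Suppose (ω', ψ') is a smooth, space-periodic solution of the linearized system ∂ω'/∂t + ∇⊥ψ' · ∇ω + ∇⊥ψ · ∇ω' − νΔω' = 0, Δψ' + ω' = 0, with ω'(·,0) = φ', and suppose (ω*, ψ*) is a smooth, space-periodic solution of the adjoint system −∂ω*/∂t − ∇⊥ψ · ∇ω* + ψ* − νΔω* = −(2ν/T)Δω, Δψ* − ∇⊥·(ω* ∇ω) = 0, with terminal condition ω*(·,T) = 0. Then the Gâteaux differential of the enstrophy dissipation admits the adjoint-based representation: −(2ν/T) ∫₀ᵀ ∫_{[0,1]²} (Δω(x,t)) ω'(x,t) dx dt = ∫_{[0,1]²} φ'(x) ω*(x,0) dx. -/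

import Mathlib

open MeasureTheory Set

noncomputable section

/-- First spatial partial derivative ∂f/∂x₁. -/
def pd1 (f : ℝ × ℝ → ℝ) (x : ℝ × ℝ) : ℝ := fderiv ℝ f x (1, 0)

/-- Second spatial partial derivative ∂f/∂x₂. -/
def pd2 (f : ℝ × ℝ → ℝ) (x : ℝ × ℝ) : ℝ := fderiv ℝ f x (0, 1)

/-- Laplacian Δf = ∂²f/∂x₁² + ∂²f/∂x₂². -/
def lap (f : ℝ × ℝ → ℝ) (x : ℝ × ℝ) : ℝ := pd1 (pd1 f) x + pd2 (pd2 f) x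

/-- |∇f|². -/
def gradSq (f : ℝ × ℝ → ℝ) (x : ℝ × ℝ) : ℝ := (pd1 f x) ^ 2 + (pd2 f x) ^ 2

/-- ∇f · ∇g. -/
def gradDot (f g : ℝ × ℝ → ℝ) (x : ℝ × ℝ) : ℝ := pd1 f x * pd1 g x + pd2 f x * pd2 g x

/-- The advection term ∇⊥ψ · ∇ω, where ∇⊥ψ = (−∂ψ/∂x₂, ∂ψ/∂x₁). -/
def adv (ψ ω : ℝ × ℝ → ℝ) (x : ℝ × ℝ) : ℝ := (-(pd2 ψ x)) * pd1 ω x + pd1 ψ x * pd2 ω x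

/-- ℤ²-periodicity. -/
def Per (f : ℝ × ℝ → ℝ) : Prop := ∀ (x : ℝ × ℝ) (n m : ℤ), f (x.1 + (n : ℝ), x.2 + (m : ℝ)) = f x

/-- The fundamental domain [0,1]² of the torus 𝕋². -/
def Q : Set (ℝ × ℝ) := Icc (0:ℝ) 1 ×ˢ Icc (0:ℝ) 1

/-- Time slice of a time-dependent field: `sl f t = f(·, t)`. -/
def sl (f : ℝ × ℝ → ℝ → ℝ) (t : ℝ) : ℝ × ℝ → ℝ := fun x => f x t

/-- Joint smoothness on ℝ² × ℝ (representing smoothness on ℝ² × [0,T]). -/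
def SmoothST (f : ℝ × ℝ → ℝ → ℝ) : Prop :=
  ContDiff ℝ (⊤ : ℕ∞) (fun p : (ℝ × ℝ) × ℝ => f p.1 p.2)

/-- ℤ²-periodicity in the space variable at every time in [0,T]. -/
def PerST (T : ℝ) (f : ℝ × ℝ → ℝ → ℝ) : Prop := ∀ t ∈ Icc (0:ℝ) T, Per (sl f t)

/-- (ω, ψ) is a smooth, space-periodic solution of the 2D vorticity Navier–Stokes
equations with viscosity ν on ℝ² × [0,T]:
∂ω/∂t + ∇⊥ψ · ∇ω = νΔω and −Δψ = ω. -/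
def IsNSSol (ν T : ℝ) (ω ψ : ℝ × ℝ → ℝ → ℝ) : Prop :=
  SmoothST ω ∧ SmoothST ψ ∧ PerST T ω ∧ PerST T ψ ∧
  (∀ (x : ℝ × ℝ), ∀ t ∈ Icc (0:ℝ) T,
    deriv (fun s => ω x s) t + adv (sl ψ t) (sl ω t) x = ν * lap (sl ω t) x) ∧
  (∀ (x : ℝ × ℝ), ∀ t ∈ Icc (0:ℝ) T, -(lap (sl ψ t) x) = ω x t)

/-- (ω, ψ) is a smooth, space-periodic solution of the inviscid 2D Euler equations
in vorticity form on ℝ² × [0,T]: ∂ω/∂t + ∇⊥ψ · ∇ω = 0 and −Δψ = ω. -/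
def IsEulerSol (T : ℝ) (ω ψ : ℝ × ℝ → ℝ → ℝ) : Prop :=
  SmoothST ω ∧ SmoothST ψ ∧ PerST T ω ∧ PerST T ψ ∧
  (∀ (x : ℝ × ℝ), ∀ t ∈ Icc (0:ℝ) T,
    deriv (fun s => ω x s) t + adv (sl ψ t) (sl ω t) x = 0) ∧
  (∀ (x : ℝ × ℝ), ∀ t ∈ Icc (0:ℝ) T, -(lap (sl ψ t) x) = ω x t)

/-- Enstrophy E(t) = ½ ∫_{[0,1]²} |ω(x,t)|² dx. -/
def ens (ω : ℝ × ℝ → ℝ → ℝ) (t : ℝ) : ℝ := (1/2) * ∫ x in Q, (ω x t) ^ 2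

/-- Palinstrophy P(t) = ½ ∫_{[0,1]²} |∇ω(x,t)|² dx. -/
def pal (ω : ℝ × ℝ → ℝ → ℝ) (t : ℝ) : ℝ := (1/2) * ∫ x in Q, gradSq (sl ω t) x

/-- ∇⊥·(a ∇b) = −∂/∂x₂(a ∂b/∂x₁) + ∂/∂x₁(a ∂b/∂x₂), the perpendicular divergence of
the vector field a∇b. -/
def perpDiv (a b : ℝ × ℝ → ℝ) (x : ℝ × ℝ) : ℝ :=
  -(pd2 (fun y => a y * pd1 b y) x) + pd1 (fun y => a y * pd2 b y) x

/-- (ω', ψ') is a smooth, space-periodic solution of the Navier–Stokes system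
linearized around (ω, ψ), with initial perturbation φ'. -/
def IsLinSol (ν T : ℝ) (ω ψ ω' ψ' : ℝ × ℝ → ℝ → ℝ) (φ' : ℝ × ℝ → ℝ) : Prop :=
  SmoothST ω' ∧ SmoothST ψ' ∧ PerST T ω' ∧ PerST T ψ' ∧
  (∀ (x : ℝ × ℝ), ∀ t ∈ Icc (0:ℝ) T,
    deriv (fun s => ω' x s) t + adv (sl ψ' t) (sl ω t) x
      + adv (sl ψ t) (sl ω' t) x - ν * lap (sl ω' t) x = 0) ∧
  (∀ (x : ℝ × ℝ), ∀ t ∈ Icc (0:ℝ) T, lap (sl ψ' t) x + ω' x t = 0) ∧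
  (∀ x : ℝ × ℝ, ω' x 0 = φ' x)

/-- (ω*, ψ*) is a smooth, space-periodic solution of the adjoint system with source
−(2ν/T)Δω and terminal condition ω*(·,T) = 0. -/
def IsAdjSol (ν T : ℝ) (ω ψ ωs ψs : ℝ × ℝ → ℝ → ℝ) : Prop :=
  SmoothST ωs ∧ SmoothST ψs ∧ PerST T ωs ∧ PerST T ψs ∧
  (∀ (x : ℝ × ℝ), ∀ t ∈ Icc (0:ℝ) T,
    -(deriv (fun s => ωs x s) t) - adv (sl ψ t) (sl ωs t) x
      + ψs x t - ν * lap (sl ωs t) x = -(2 * ν / T) * lap (sl ω t) x) ∧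
  (∀ (x : ℝ × ℝ), ∀ t ∈ Icc (0:ℝ) T,
    lap (sl ψs t) x - perpDiv (sl ωs t) (sl ω t) x = 0) ∧
  (∀ x : ℝ × ℝ, ωs x T = 0)

section Smooth

open scoped ContDiff

lemma ContDiff.pd1 {f : ℝ × ℝ → ℝ} (hf : ContDiff ℝ ∞ f) : ContDiff ℝ ∞ (pd1 f) :=
  (contDiff_infty_iff_fderiv.1 hf).2.clm_apply contDiff_const

lemma ContDiff.pd2 {f : ℝ × ℝ → ℝ} (hf : ContDiff ℝ ∞ f) : ContDiff ℝ ∞ (pd2 f) :=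
  (contDiff_infty_iff_fderiv.1 hf).2.clm_apply contDiff_const

lemma ContDiff.lap {f : ℝ × ℝ → ℝ} (hf : ContDiff ℝ ∞ f) : ContDiff ℝ ∞ (lap f) :=
  hf.pd1.pd1.add hf.pd2.pd2

lemma Per.fderiv_eq {f : ℝ × ℝ → ℝ} (hf : Per f) (x : ℝ × ℝ) (n m : ℤ) :
    fderiv ℝ f (x.1 + (n : ℝ), x.2 + (m : ℝ)) = fderiv ℝ f x := by
  have h : (fun y : ℝ × ℝ => f (y + ((n : ℝ), (m : ℝ)))) = f := funext fun y => hf y n m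
  have h2 := fderiv_comp_add_right (𝕜 := ℝ) (f := f) (x := x) ((n : ℝ), (m : ℝ))
  rw [h] at h2
  exact h2.symm

lemma Per.pd1 {f : ℝ × ℝ → ℝ} (hf : Per f) : Per (pd1 f) := fun x n m => by
  simp only [_root_.pd1, hf.fderiv_eq x n m]

lemma Per.pd2 {f : ℝ × ℝ → ℝ} (hf : Per f) : Per (pd2 f) := fun x n m => by
  simp only [_root_.pd2, hf.fderiv_eq x n m]

/-- Mixed second partial derivatives of a smooth function commute. -/
lemma pd1_pd2_comm {f : ℝ × ℝ → ℝ} (hf : ContDiff ℝ ∞ f) (x : ℝ × ℝ) :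
    pd1 (pd2 f) x = pd2 (pd1 f) x := by
  have hd : DifferentiableAt ℝ (fderiv ℝ f) x :=
    ((contDiff_infty_iff_fderiv.1 hf).2.differentiable (by simp)) x
  have hs : IsSymmSndFDerivAt ℝ f x :=
    (hf.of_le (mod_cast le_top : ((2 : ℕ∞) : ℕ∞ω) ≤ ∞)).contDiffAt.isSymmSndFDerivAt (by simp)
  have key (v w : ℝ × ℝ) :
      fderiv ℝ (fun y => fderiv ℝ f y v) x w = fderiv ℝ (fderiv ℝ f) x w v := by
    rw [fderiv_clm_apply hd (differentiableAt_const v)]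
    simp
  change fderiv ℝ (fun y => fderiv ℝ f y (0, 1)) x (1, 0)
    = fderiv ℝ (fun y => fderiv ℝ f y (1, 0)) x (0, 1)
  rw [key, key]
  exact hs _ _

lemma isCompact_Q : IsCompact Q := isCompact_Icc.prod isCompact_Icc

/-- The divergence of a smooth periodic vector field integrates to zero over the torus. -/
lemma integral_Q_div_eq_zero {F G : ℝ × ℝ → ℝ} (hF : ContDiff ℝ ∞ F) (hG : ContDiff ℝ ∞ G)
    (pF : Per F) (pG : Per G) : ∫ x in Q, (pd1 F x + pd2 G x) = 0 := by
  have hQ : Q = Icc ((0 : ℝ), (0 : ℝ)) (1, 1) := Icc_prod_Icc 0 1 0 1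
  have hFd := hF.differentiable (by simp)
  have hGd := hG.differentiable (by simp)
  have h := integral_divergence_prod_Icc_of_hasFDerivAt_of_le F G (fderiv ℝ F) (fderiv ℝ G)
    ((0 : ℝ), (0 : ℝ)) (1, 1) (by simp [Prod.le_def]) hF.continuous.continuousOn
    hG.continuous.continuousOn (fun x _ => (hFd x).hasFDerivAt) (fun x _ => (hGd x).hasFDerivAt)
    ((hF.pd1.continuous.add hG.pd2.continuous).continuousOn.integrableOn_compact isCompact_Icc)
  have h1 (y : ℝ) : F (1, y) = F (0, y) := by simpa using pF (0, y) 1 0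
  have h2 (y : ℝ) : G (y, 1) = G (y, 0) := by simpa using pG (y, 0) 0 1
  rw [hQ]
  refine h.trans ?_
  simp [h1, h2]

/-- Duality between the spatial parts of the linearized and the adjoint operators. -/
lemma integral_Q_lin_adj_eq_zero (ν : ℝ) {w p w' p' s q : ℝ × ℝ → ℝ}
    (hw : ContDiff ℝ ∞ w) (hp : ContDiff ℝ ∞ p) (hw' : ContDiff ℝ ∞ w') (hp' : ContDiff ℝ ∞ p')
    (hs : ContDiff ℝ ∞ s) (hq : ContDiff ℝ ∞ q)
    (pw : Per w) (pp : Per p) (pw' : Per w') (pp' : Per p') (ps : Per s) (pq : Per q)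
    (hlin : ∀ x, lap p' x + w' x = 0) (hadj : ∀ x, lap q x - perpDiv s w x = 0) :
    ∫ x in Q, ((ν * lap w' x - adv p' w x - adv p w' x) * s x
      + w' x * (q x - adv p s x - ν * lap s x)) = 0 := by
  let F : ℝ × ℝ → ℝ := fun x => pd2 p x * (w' x * s x) + ν * (s x * pd1 w' x - w' x * pd1 s x)
    - (pd1 p' x * q x - p' x * pd1 q x) - p' x * (s x * pd2 w x)
  let G : ℝ × ℝ → ℝ := fun x => ν * (s x * pd2 w' x - w' x * pd2 s x) - pd1 p x * (w' x * s x)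
    - (pd2 p' x * q x - p' x * pd2 q x) + p' x * (s x * pd1 w x)
  have hF : ContDiff ℝ ∞ F := ((((hp.pd2.mul (hw'.mul hs)).add (contDiff_const.mul
    ((hs.mul hw'.pd1).sub (hw'.mul hs.pd1)))).sub ((hp'.pd1.mul hq).sub (hp'.mul hq.pd1))).sub
    (hp'.mul (hs.mul hw.pd2)))
  have hG : ContDiff ℝ ∞ G := ((((contDiff_const.mul
    ((hs.mul hw'.pd2).sub (hw'.mul hs.pd2))).sub (hp.pd1.mul (hw'.mul hs))).sub
    ((hp'.pd2.mul hq).sub (hp'.mul hq.pd2))).add (hp'.mul (hs.mul hw.pd1)))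
  have pF : Per F := fun x n m => by
    simp only [F, pw' x n m, pp' x n m, ps x n m, pq x n m, pp.pd2 x n m, pw'.pd1 x n m,
      ps.pd1 x n m, pp'.pd1 x n m, pq.pd1 x n m, pw.pd2 x n m]
  have pG : Per G := fun x n m => by
    simp only [G, pw' x n m, pp' x n m, ps x n m, pq x n m, pp.pd1 x n m, pw'.pd2 x n m,
      ps.pd2 x n m, pp'.pd2 x n m, pq.pd2 x n m, pw.pd1 x n m]
  rw [← integral_Q_div_eq_zero hF hG pF pG]
  congr 1
  funext x
  have D {f : ℝ × ℝ → ℝ} (hf : ContDiff ℝ ∞ f) : HasFDerivAt f (fderiv ℝ f x) x :=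
    (hf.differentiable (by simp) x).hasFDerivAt
  have dF : HasFDerivAt F _ x := (((((D hp.pd2).mul ((D hw').mul (D hs))).add
    ((((D hs).mul (D hw'.pd1)).sub ((D hw').mul (D hs.pd1))).const_mul ν)).sub
    (((D hp'.pd1).mul (D hq)).sub ((D hp').mul (D hq.pd1)))).sub
    ((D hp').mul ((D hs).mul (D hw.pd2))))
  have dG : HasFDerivAt G _ x := (((((((D hs).mul (D hw'.pd2)).sub
    ((D hw').mul (D hs.pd2))).const_mul ν).sub ((D hp.pd1).mul ((D hw').mul (D hs)))).sub
    (((D hp'.pd2).mul (D hq)).sub ((D hp').mul (D hq.pd2)))).add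
    ((D hp').mul ((D hs).mul (D hw.pd1))))
  have e1 : pd1 F x = fderiv ℝ F x (1, 0) := rfl
  have e2 : pd2 G x = fderiv ℝ G x (0, 1) := rfl
  have d1 : pd1 (fun y => s y * pd2 w y) x = s x * pd1 (pd2 w) x + pd2 w x * pd1 s x := by
    have h : HasFDerivAt (fun y => s y * pd2 w y) _ x := (D hs).mul (D hw.pd2)
    simp [pd1, h.fderiv]
  have d2 : pd2 (fun y => s y * pd1 w y) x = s x * pd2 (pd1 w) x + pd1 w x * pd2 s x := by
    have h : HasFDerivAt (fun y => s y * pd1 w y) _ x := (D hs).mul (D hw.pd1)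
    simp [pd2, h.fderiv]
  have hc := pd1_pd2_comm hp x
  have hl := hlin x
  have ha := hadj x
  rw [e1, e2, dF.fderiv, dG.fderiv]
  simp only [perpDiv, d1, d2] at ha
  have r1 (f : ℝ × ℝ → ℝ) : fderiv ℝ f x (1, 0) = pd1 f x := rfl
  have r2 (f : ℝ × ℝ → ℝ) : fderiv ℝ f x (0, 1) = pd2 f x := rfl
  simp only [add_apply, sub_apply, smul_apply, Pi.mul_apply, smul_eq_mul, r1, r2]
  simp only [lap, adv] at hl ha ⊢
  linear_combination q x * hl - p' x * ha - w' x * s x * hc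

lemma SmoothST.slice {f : ℝ × ℝ → ℝ → ℝ} (hf : SmoothST f) (t : ℝ) : ContDiff ℝ ∞ (sl f t) :=
  hf.comp (contDiff_id.prodMk contDiff_const)

lemma SmoothST.time {f : ℝ × ℝ → ℝ → ℝ} (hf : SmoothST f) (x : ℝ × ℝ) :
    ContDiff ℝ ∞ (f x) :=
  hf.comp (contDiff_const.prodMk contDiff_id)

lemma SmoothST.continuous_deriv {f : ℝ × ℝ → ℝ → ℝ} (hf : SmoothST f) :
    Continuous fun p : (ℝ × ℝ) × ℝ => deriv (f p.1) p.2 := by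
  have h : (fun p : (ℝ × ℝ) × ℝ => deriv (f p.1) p.2) =
      fun p => fderiv ℝ (fun p : (ℝ × ℝ) × ℝ => f p.1 p.2) p (0, 1) := by
    funext p
    have h1 : HasFDerivAt (fun p : (ℝ × ℝ) × ℝ => f p.1 p.2) _ (p.1, p.2) :=
      (hf.differentiable (by simp) p).hasFDerivAt
    have h2 : HasDerivAt (fun s : ℝ => (p.1, s)) ((0 : ℝ × ℝ), (1 : ℝ)) p.2 :=
      (hasDerivAt_const _ _).prodMk (hasDerivAt_id _)
    exact (h1.comp_hasDerivAt p.2 h2).deriv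
  rw [h]
  exact ((contDiff_infty_iff_fderiv.1 hf).2.clm_apply contDiff_const).continuous

lemma SmoothST.mul {f g : ℝ × ℝ → ℝ → ℝ} (hf : SmoothST f) (hg : SmoothST g) :
    SmoothST fun x t => f x t * g x t :=
  ContDiff.mul hf hg

/-- Fundamental theorem of calculus for the spatial integral of a smooth field. -/
lemma SmoothST.integral_deriv {f : ℝ × ℝ → ℝ → ℝ} (hf : SmoothST f) {T : ℝ} :
    ∫ t in (0 : ℝ)..T, ∫ x in Q, deriv (f x) t = ∫ x in Q, (f x T - f x 0) := by
  rw [intervalIntegral_integral_swap]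
  · congr 1
    funext x
    exact intervalIntegral.integral_deriv_eq_sub
      (fun t _ => (hf.time x).differentiable (by simp) t)
      ((hf.continuous_deriv.comp (Continuous.prodMk_right x)).intervalIntegrable _ _)
  · rw [Measure.prod_restrict]
    have hc : Continuous (Function.uncurry fun (t : ℝ) (x : ℝ × ℝ) => deriv (f x) t) :=
      hf.continuous_deriv.comp continuous_swap
    exact (hc.continuousOn.integrableOn_compact (isCompact_uIcc.prod isCompact_Q)).mono_set
      (prod_mono_left uIoc_subset_uIcc)

end Smooth

/-- Adjoint-based representation of the Gâteaux differential of the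
enstrophy dissipation: −(2ν/T) ∫₀ᵀ ∫ (Δω) ω' dx dt = ∫ φ' ω*(·,0) dx. -/
theorem adjoint_representation_of_gateaux_differential
    (ν T : ℝ) (hν : 0 < ν) (hT : 0 < T)
    (ω ψ ω' ψ' ωs ψs : ℝ × ℝ → ℝ → ℝ) (φ' : ℝ × ℝ → ℝ)
    (hNS : IsNSSol ν T ω ψ)
    (hlin : IsLinSol ν T ω ψ ω' ψ' φ')
    (hadj : IsAdjSol ν T ω ψ ωs ψs) :
    -(2 * ν / T) * ∫ t in (0:ℝ)..T, ∫ x in Q, lap (sl ω t) x * ω' x t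
      = ∫ x in Q, φ' x * ωs x 0 := by
  obtain ⟨sω, sψ, pω, pψ, -, -⟩ := hNS
  obtain ⟨sω', sψ', pω', pψ', elin, elin', hinit⟩ := hlin
  obtain ⟨sωs, sψs, pωs, pψs, eadj, eadj', hterm⟩ := hadj
  have hslice : ∀ t ∈ uIcc 0 T, ∫ x in Q, deriv (fun s => ω' x s * ωs x s) t
      = (2 * ν / T) * ∫ x in Q, lap (sl ω t) x * ω' x t := by
    intro t ht
    rw [uIcc_of_le hT.le] at ht
    have hzero := integral_Q_lin_adj_eq_zero ν (sω.slice t) (sψ.slice t) (sω'.slice t)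
      (sψ'.slice t) (sωs.slice t) (sψs.slice t) (pω t ht) (pψ t ht) (pω' t ht) (pψ' t ht)
      (pωs t ht) (pψs t ht) (fun x => elin' x t ht) (fun x => eadj' x t ht)
    have hint : IntegrableOn (fun x => (2 * ν / T) * (lap (sl ω t) x * ω' x t)) Q :=
      (continuous_const.mul ((sω.slice t).lap.continuous.mul
        (sω'.slice t).continuous)).continuousOn.integrableOn_compact isCompact_Q
    have hint' : IntegrableOn (fun x => deriv (fun s => ω' x s * ωs x s) t) Q :=
      ((sω'.mul sωs).continuous_deriv.comp
        (Continuous.prodMk_left t)).continuousOn.integrableOn_compact isCompact_Q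
    rw [← integral_const_mul, ← sub_eq_zero, ← integral_sub hint' hint, ← hzero]
    congr 1
    funext x
    have hd : deriv (fun s => ω' x s * ωs x s) t = _ :=
      deriv_fun_mul ((sω'.time x).differentiable (by simp) t)
        ((sωs.time x).differentiable (by simp) t)
    rw [hd]
    simp only [sl] at *
    linear_combination ωs x t * elin x t ht - ω' x t * eadj x t ht
  have hftc := (sω'.mul sωs).integral_deriv (T := T)
  rw [intervalIntegral.integral_congr hslice, intervalIntegral.integral_const_mul] at hftc
  simp only [hterm, hinit, mul_zero, zero_sub, integral_neg] at hftc
  rw [neg_mul, hftc, neg_neg]
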